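/- Let f, g be nonnegative functions on Z/pZ, let h_1, ..., h_n be △-regular, and let s_1, ..., s_{2m} be □-regular nonnegative functions. Then f ⋆ g ⋆ h_1 ⋆ ... ⋆ h_n ⋆ s_1 ⋆ ... ⋆ s_{2m}(0) ≤ f^+ ⋆ g^- ⋆ h_1^* ⋆ ... ⋆ h_n^* ⋆ s_1^+ ⋆ s_2^- ⋆ ... ⋆ s_{2m-1}^+ ⋆ s_{2m}^-(0). -/

import Mathlib

open scoped BigOperators ENNReal Classical

namespace Paper

variable {p : ℕ}

/-- Convolution of two functions on `ZMod p`. -/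
noncomputable def conv [NeZero p] (f g : ZMod p → ℝ) : ZMod p → ℝ :=
  fun k => ∑ i : ZMod p, f i * g (k - i)

/-- Iterated convolution of a list of functions (the delta mass at `0` is the
convolution identity used as the base of the fold). -/
noncomputable def convList [NeZero p] (l : List (ZMod p → ℝ)) : ZMod p → ℝ :=
  l.foldr conv (fun k => if k = 0 then 1 else 0)

/-- The enumeration `0, +1, -1, +2, -2, ...` of `ZMod p`. -/
def plusSeq (p : ℕ) (n : ℕ) : ZMod p :=
  if n % 2 = 0 then -((n / 2 : ℕ) : ZMod p) else (((n + 1) / 2 : ℕ) : ZMod p)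

/-- The enumeration `0, -1, +1, -2, +2, ...` of `ZMod p`. -/
def minusSeq (p : ℕ) (n : ℕ) : ZMod p := -(plusSeq p n)

/-- `fp` is the `+`-rearrangement of `f`: a permutation of the values of `f` that is
nonincreasing along the ordering `0, +1, -1, +2, -2, ...`. -/
def IsPlusRearr (f fp : ZMod p → ℝ) : Prop :=
  (∃ σ : Equiv.Perm (ZMod p), fp = f ∘ σ) ∧
    ∀ n : ℕ, n + 1 < p → fp (plusSeq p (n + 1)) ≤ fp (plusSeq p n)

/-- `fm` is the `-`-rearrangement of `f`: a permutation of the values of `f` that is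
nonincreasing along the ordering `0, -1, +1, -2, +2, ...`. -/
def IsMinusRearr (f fm : ZMod p → ℝ) : Prop :=
  (∃ σ : Equiv.Perm (ZMod p), fm = f ∘ σ) ∧
    ∀ n : ℕ, n + 1 < p → fm (minusSeq p (n + 1)) ≤ fm (minusSeq p n)

/-- `f` is `△`-regular: its `+`-rearrangement is symmetric (so `f⁺ = f⁻`). -/
def TriangleRegular (f : ZMod p → ℝ) : Prop :=
  ∃ fp, IsPlusRearr f fp ∧ ∀ z, fp (-z) = fp z

/-- `f` is `□`-regular: `f⁺(z+1) = f⁻(z)` for all `z`. -/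
def SquareRegular (f : ZMod p → ℝ) : Prop :=
  ∃ fp fm, IsPlusRearr f fp ∧ IsMinusRearr f fm ∧ ∀ z, fp (z + 1) = fm z

/-- probability mass function on `ZMod p`. -/
def IsPMF [NeZero p] (f : ZMod p → ℝ) : Prop :=
  (∀ i, 0 ≤ f i) ∧ ∑ i : ZMod p, f i = 1

/-- Weak majorization: for every `r`, the sum of the `r` largest values of `f` is at most
the sum of the `r` largest values of `g` (expressed via subsets of each cardinality). -/
def WeakMaj [NeZero p] (f g : ZMod p → ℝ) : Prop :=
  ∀ s : Finset (ZMod p), ∃ t : Finset (ZMod p),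
    t.card = s.card ∧ ∑ i ∈ s, f i ≤ ∑ i ∈ t, g i

/-- Majorization: weak majorization together with equality of total sums. -/
def Maj [NeZero p] (f g : ZMod p → ℝ) : Prop :=
  WeakMaj f g ∧ ∑ i : ZMod p, f i = ∑ i : ZMod p, g i

/-- `f` and `g` are shape-equivalent: there is a single ordering of the index set along
which both are nonincreasing. -/
def ShapeEquiv [NeZero p] (f g : ZMod p → ℝ) : Prop :=
  ∃ e : Fin p ≃ ZMod p, (∀ m n : Fin p, m ≤ n → f (e n) ≤ f (e m)) ∧
    (∀ m n : Fin p, m ≤ n → g (e n) ≤ g (e m))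

/-- Rényi entropy of order `α ∈ [0,∞]` of a pmf on `ZMod p`. -/
noncomputable def renyi [NeZero p] (α : ℝ≥0∞) (f : ZMod p → ℝ) : ℝ :=
  if α = 0 then Real.log ((Finset.univ.filter (fun i => f i ≠ 0)).card)
  else if α = 1 then ∑ i : ZMod p, Real.negMulLog (f i)
  else if α = ⊤ then -Real.log (⨆ i : ZMod p, f i)
  else (1 - α.toReal)⁻¹ * Real.log (∑ i : ZMod p, f i ^ α.toReal)

/-- The enumeration underlying the `+`-order (`true`) or the `-`-order (`false`). -/
def ordSeq (p : ℕ) : Bool → ℕ → ZMod p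
  | true => plusSeq p
  | false => minusSeq p

/-- The left end of the interval formed by the first `L` terms of `ordSeq`. -/
def ordStart : Bool → ℕ → ℤ
  | true, L => 1 - (((L + 1) / 2 : ℕ) : ℤ)
  | false, L => -((L / 2 : ℕ) : ℤ)

/-- The interval `{s, s + 1, ..., s + L - 1}` in `ZMod p`. -/
def arc (p : ℕ) (s : ℤ) (L : ℕ) : Finset (ZMod p) :=
  (Finset.range L).image fun k : ℕ => ((s + k : ℤ) : ZMod p)

/-- The number of triples in `A × B × C` with sum `0`. -/
def zeroSumCount (A B C : Finset (ZMod p)) : ℕ :=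
  ∑ x ∈ A, ∑ y ∈ B, if -(x + y) ∈ C then 1 else 0

section Arcs

lemma mem_arc_of {s : ℤ} {L : ℕ} {x : ZMod p} (t : ℤ) (hx : x = (t : ZMod p)) (h1 : s ≤ t)
    (h2 : t < s + L) : x ∈ arc p s L := by
  refine Finset.mem_image.2 ⟨(t - s).toNat, ?_, ?_⟩
  · rw [Finset.mem_range]; omega
  · rw [hx]; congr 1; omega

lemma intCast_add_injOn (s : ℤ) :
    Set.InjOn (fun k : ℕ => ((s + k : ℤ) : ZMod p)) (Finset.range p) := by
  intro k hk l hl h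
  simp only [Finset.coe_range, Set.mem_Iio] at hk hl
  simp only [Int.cast_add, Int.cast_natCast, add_right_inj] at h
  rw [ZMod.natCast_eq_natCast_iff'] at h
  rwa [Nat.mod_eq_of_lt hk, Nat.mod_eq_of_lt hl] at h

lemma sum_arc {M : Type*} [AddCommMonoid M] (s : ℤ) {L : ℕ} (hL : L ≤ p) (φ : ZMod p → M) :
    ∑ x ∈ arc p s L, φ x = ∑ k ∈ Finset.range L, φ ((s + k : ℤ) : ZMod p) := by
  refine Finset.sum_image ((intCast_add_injOn s).mono ?_)
  simpa using Set.Iio_subset_Iio hL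

lemma card_arc (s : ℤ) {L : ℕ} (hL : L ≤ p) : (arc p s L).card = L := by
  rw [Finset.card_eq_sum_ones, sum_arc s hL]; simp

lemma compl_arc [NeZero p] (s : ℤ) {L : ℕ} (hL : L ≤ p) :
    (arc p s L)ᶜ = arc p (s + L) (p - L) := by
  symm
  apply Finset.eq_of_subset_of_card_le
  · intro x hx
    obtain ⟨k, hk, rfl⟩ := Finset.mem_image.1 hx
    rw [Finset.mem_range] at hk
    rw [Finset.mem_compl]
    intro h
    obtain ⟨l, hl, h⟩ := Finset.mem_image.1 h
    rw [Finset.mem_range] at hl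
    have := intCast_add_injOn (p := p) s (x₁ := l) (x₂ := L + k) (by simp; omega)
      (by simp; omega) (by simp only [h]; push_cast; ring_nf)
    omega
  · rw [Finset.card_compl, card_arc s hL, card_arc _ (by omega), ZMod.card]

lemma compl_arc' [NeZero p] (s : ℤ) {L : ℕ} (hL : L ≤ p) :
    (arc p s L)ᶜ = arc p (s + L - p) (p - L) := by
  rw [compl_arc s hL]
  simp [arc]

lemma min_le_sum_arc (x d : ℤ) (L c : ℕ) (h1 : -1 ≤ 2 * x + L - 1 + (2 * d + c - 1))
    (h2 : 2 * x + L - 1 + (2 * d + c - 1) ≤ 1) :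
    min c L ≤ ∑ k ∈ Finset.range L, if -((x + k : ℤ) : ZMod p) ∈ arc p d c then 1 else 0 := by
  rw [← Finset.card_filter]
  have key : Finset.Ico (1 - (x + d) - c).toNat ((1 - (x + d) - c).toNat + min c L) ⊆
      (Finset.range L).filter fun k : ℕ => -((x + k : ℤ) : ZMod p) ∈ arc p d c := by
    intro k hk
    rw [Finset.mem_Ico] at hk
    rw [Finset.mem_filter, Finset.mem_range]
    refine ⟨by omega, mem_arc_of (-(x + k)) (by push_cast; ring) (by omega) (by omega)⟩
  simpa using Finset.card_le_card key

lemma sum_range_sum_range_add {M : Type*} [AddCommMonoid M] (b : ℕ) :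
    ∀ (a : ℕ) (φ : ℕ → M), b ≤ a →
    ∑ k ∈ Finset.range a, ∑ l ∈ Finset.range b, φ (k + l) =
      ∑ j ∈ Finset.range b, ∑ k ∈ Finset.range (a + b - 1 - 2 * j), φ (j + k) := by
  induction b with
  | zero => simp
  | succ b ih =>
    intro a φ hab
    obtain ⟨a, rfl⟩ : ∃ a', a = a' + 1 := ⟨a - 1, by omega⟩
    rw [Finset.sum_range_succ']
    simp_rw [Finset.sum_range_succ (fun l => φ (_ + 1 + l)) b]
    rw [Finset.sum_add_distrib]
    have h1 := ih a (fun k => φ (k + 1)) (by omega)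
    have h2 : ∀ k l, k + 1 + l = k + l + 1 := by intros; omega
    simp_rw [h2]
    rw [h1]
    conv_rhs => rw [Finset.sum_range_succ']
    have h3 : ∀ j, a + (b + 1) + 1 - 1 - 2 * (j + 1) = a + b - 1 - 2 * j := by intros; omega
    have h4 : a + (b + 1) + 1 - 1 - 2 * 0 = (b + 1) + a := by omega
    simp_rw [h3]
    rw [h4, Finset.sum_range_add _ (b + 1) a, add_assoc]
    congr 1
    · refine Finset.sum_congr rfl fun j _ => Finset.sum_congr rfl fun k _ => ?_
      rw [show j + 1 + k = j + k + 1 by omega]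
    · rw [add_comm]
      congr 1
      refine Finset.sum_congr rfl fun k _ => ?_
      rw [show k + b + 1 = 0 + (b + 1 + k) by omega]

end Arcs

section Sets

lemma exists_translate (hp : p.Prime) {A B : Finset (ZMod p)} (hA : A.Nonempty)
    (hAp : A.card < p) (hB : 1 < B.card) :
    ∃ t : ZMod p, (∃ y ∈ B, y + t ∈ A) ∧ ∃ y ∈ B, y + t ∉ A := by
  have := Fact.mk hp
  by_contra! hcon
  obtain ⟨y, hy, z, hz, hyz⟩ := Finset.one_lt_card.1 hB
  obtain ⟨a, ha⟩ := hA
  have step : ∀ x ∈ A, x + (z - y) ∈ A := fun x hx => by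
    have := hcon (x - y) ⟨y, hy, by simpa using hx⟩ z hz
    convert this using 1; ring
  have steps : ∀ n : ℕ, a + n * (z - y) ∈ A := fun n => by
    induction n with
    | zero => simpa using ha
    | succ n ih =>
      convert step _ ih using 1; push_cast; ring
  have huniv : A = Finset.univ := by
    refine Finset.eq_univ_iff_forall.2 fun x => ?_
    have hne : z - y ≠ 0 := sub_ne_zero.2 hyz.symm
    have := steps ((x - a) / (z - y)).val
    rw [ZMod.natCast_zmod_val, div_mul_cancel₀ _ hne] at this
    simpa using this
  rw [huniv, Finset.card_univ, ZMod.card] at hAp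
  exact lt_irrefl _ hAp

lemma zeroSumCount_comm (A B C : Finset (ZMod p)) :
    zeroSumCount A B C = zeroSumCount B A C := by
  unfold zeroSumCount
  rw [Finset.sum_comm]
  simp_rw [add_comm]

lemma zeroSumCount_translate (A B C : Finset (ZMod p)) (t : ZMod p) :
    zeroSumCount A (B.map (addRightEmbedding t)) (C.map (addRightEmbedding (-t))) =
      zeroSumCount A B C := by
  unfold zeroSumCount
  simp only [Finset.sum_map, addRightEmbedding_apply]
  refine Finset.sum_congr rfl fun x _ => Finset.sum_congr rfl fun y _ => if_congr ?_ rfl rfl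
  rw [show -(x + (y + t)) = addRightEmbedding (-t) (-(x + y)) by
    simp only [addRightEmbedding_apply]; ring, Finset.mem_map']

lemma zeroSumCount_eTransform (A B C : Finset (ZMod p)) :
    zeroSumCount A B C = zeroSumCount (A ∪ B) (A ∩ B) C + zeroSumCount (A \ B) (B \ A) C := by
  have hA : ∀ φ : ZMod p → ℕ, ∑ x ∈ A, φ x = ∑ x ∈ A ∩ B, φ x + ∑ x ∈ A \ B, φ x := fun φ => by
    rw [← Finset.sum_union (Finset.disjoint_sdiff_inter A B).symm, Finset.union_comm,
      Finset.sdiff_union_inter]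
  have hB : ∀ φ : ZMod p → ℕ, ∑ x ∈ B, φ x = ∑ x ∈ A ∩ B, φ x + ∑ x ∈ B \ A, φ x := fun φ => by
    rw [Finset.inter_comm, ← Finset.sum_union (Finset.disjoint_sdiff_inter B A).symm,
      Finset.union_comm, Finset.sdiff_union_inter]
  have hU : ∀ φ : ZMod p → ℕ, ∑ x ∈ A ∪ B, φ x =
      ∑ x ∈ A ∩ B, φ x + ∑ x ∈ A \ B, φ x + ∑ x ∈ B \ A, φ x := fun φ => by
    rw [← hA, ← Finset.sum_union Finset.disjoint_sdiff, Finset.union_sdiff_self_eq_union]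
  have hcomm : ∑ x ∈ A ∩ B, ∑ y ∈ B \ A, (if -(x + y) ∈ C then 1 else 0) =
      ∑ x ∈ B \ A, ∑ y ∈ A ∩ B, if -(x + y) ∈ C then 1 else 0 :=
    zeroSumCount_comm _ _ _
  unfold zeroSumCount
  rw [hU, hA]
  simp only [hB, Finset.sum_add_distrib]
  rw [hcomm]
  ring

lemma zeroSumCount_le (hp : p.Prime) [NeZero p] (A B C : Finset (ZMod p)) (hBA : B.card ≤ A.card)
    (hAB : A.card + B.card ≤ p + 1) :
    zeroSumCount A B C ≤
      ∑ j ∈ Finset.range B.card, min C.card (A.card + B.card - 1 - 2 * j) := by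
  induction hn : B.card using Nat.strong_induction_on generalizing A B C with
  | _ n ih =>
  subst hn
  rcases Nat.lt_or_ge 1 B.card with h1 | h1
  · obtain ⟨t, ⟨y, hy, hyA⟩, z, hz, hzA⟩ :=
      exists_translate hp (A := A) (Finset.card_pos.1 (by omega)) (by omega) h1
    rw [← zeroSumCount_translate A B C t, ← Finset.card_map (s := B) (addRightEmbedding t),
      ← Finset.card_map (s := C) (addRightEmbedding (-t))]
    have hB' := Finset.card_map (s := B) (addRightEmbedding t)
    have hyB : y + t ∈ B.map (addRightEmbedding t) := Finset.mem_map_of_mem _ hy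
    have hzB : z + t ∈ B.map (addRightEmbedding t) := Finset.mem_map_of_mem _ hz
    generalize C.map (addRightEmbedding (-t)) = C' at *
    generalize B.map (addRightEmbedding t) = B' at *
    have hI : 0 < (A ∩ B').card := Finset.card_pos.2 ⟨_, Finset.mem_inter.2 ⟨hyA, hyB⟩⟩
    have hD : 0 < (B' \ A).card := Finset.card_pos.2 ⟨_, Finset.mem_sdiff.2 ⟨hzB, hzA⟩⟩
    have e1 := Finset.card_union_add_card_inter A B'
    have e2 := Finset.card_sdiff_add_card_inter A B'
    have e3 := Finset.card_sdiff_add_card_inter B' A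
    rw [Finset.inter_comm] at e3
    rw [zeroSumCount_eTransform]
    have i1 := ih _ (by omega) (A ∪ B') (A ∩ B') C' (by omega) (by omega) rfl
    have i2 := ih _ (by omega) (A \ B') (B' \ A) C' (by omega) (by omega) rfl
    refine (add_le_add i1 i2).trans (le_of_eq ?_)
    rw [e1, show Finset.range B'.card = Finset.range ((A ∩ B').card + (B' \ A).card) by
      congr 1; omega, Finset.sum_range_add]
    congr 1
    refine Finset.sum_congr rfl fun j _ => ?_
    congr 1
    omega
  · rcases Nat.le_one_iff_eq_zero_or_eq_one.1 h1 with h0 | h1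
    · rw [Finset.card_eq_zero] at h0
      simp [zeroSumCount, h0]
    · obtain ⟨y, rfl⟩ := Finset.card_eq_one.1 h1
      simp only [zeroSumCount, Finset.sum_singleton, Finset.card_singleton, Finset.range_one,
        ← Finset.card_filter]
      refine le_min ?_ ?_
      · refine Finset.card_le_card_of_injOn (fun x => -(x + y)) (fun x hx => ?_) ?_
        · exact (Finset.mem_filter.1 hx).2
        · intro x _ x' _ h
          simpa using h
      · exact (Finset.card_filter_le _ _).trans (by omega)

lemma zeroSumCount_univ [NeZero p] (B C : Finset (ZMod p)) :
    zeroSumCount Finset.univ B C = B.card * C.card := by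
  rw [zeroSumCount_comm, zeroSumCount, Finset.card_eq_sum_ones B, Finset.sum_mul]
  refine Finset.sum_congr rfl fun x _ => ?_
  rw [one_mul, ← Finset.card_filter]
  refine Finset.card_bij (fun y _ => -(x + y)) (fun y hy => (Finset.mem_filter.1 hy).2)
    (fun y _ y' _ h => by simpa using h) fun z hz => ⟨-(x + z), ?_, by ring⟩
  rw [Finset.mem_filter]
  exact ⟨Finset.mem_univ _, by convert hz using 1; ring⟩

lemma zeroSumCount_add_compl [NeZero p] (A B C : Finset (ZMod p)) :
    zeroSumCount A B C + zeroSumCount Aᶜ B C = B.card * C.card := by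
  rw [← zeroSumCount_univ]
  exact Finset.sum_add_sum_compl A _

lemma zeroSumCount_le_arc (hp : p.Prime) [NeZero p] (A B C : Finset (ZMod p)) (s t d : ℤ)
    (h1 : -1 ≤ 2 * s + A.card - 1 + (2 * t + B.card - 1) + (2 * d + C.card - 1))
    (h2 : 2 * s + A.card - 1 + (2 * t + B.card - 1) + (2 * d + C.card - 1) ≤ 1) :
    zeroSumCount A B C ≤
      zeroSumCount (arc p s A.card) (arc p t B.card) (arc p d C.card) := by
  have hle : ∀ S : Finset (ZMod p), S.card ≤ p := fun S => by
    simpa [ZMod.card] using Finset.card_le_univ S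
  wlog hBA : B.card ≤ A.card generalizing A B s t
  · rw [zeroSumCount_comm, zeroSumCount_comm (arc p s A.card)]
    exact this B A t s (by omega) (by omega) (by omega)
  have small : ∀ (A B : Finset (ZMod p)) (s t : ℤ),
      -1 ≤ 2 * s + A.card - 1 + (2 * t + B.card - 1) + (2 * d + C.card - 1) →
      2 * s + A.card - 1 + (2 * t + B.card - 1) + (2 * d + C.card - 1) ≤ 1 →
      B.card ≤ A.card → A.card + B.card ≤ p + 1 → zeroSumCount A B C ≤
        zeroSumCount (arc p s A.card) (arc p t B.card) (arc p d C.card) := by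
    intro A B s t h1 h2 hBA hAB
    refine (zeroSumCount_le hp A B C hBA hAB).trans ?_
    rw [zeroSumCount, sum_arc _ (hle A)]
    simp_rw [sum_arc _ (hle B)]
    have := sum_range_sum_range_add B.card A.card
      (fun m : ℕ => if -((s + t + m : ℤ) : ZMod p) ∈ arc p d C.card then 1 else 0) hBA
    have hcast : ∀ k l : ℕ, ((s + k : ℤ) : ZMod p) + ((t + l : ℤ) : ZMod p) =
        ((s + t + (k + l : ℕ) : ℤ) : ZMod p) := fun k l => by push_cast; ring
    simp_rw [hcast]
    rw [this]
    refine Finset.sum_le_sum fun j hj => ?_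
    rw [Finset.mem_range] at hj
    have := min_le_sum_arc (p := p) (s + t + j) d (A.card + B.card - 1 - 2 * j) C.card
      (by omega) (by omega)
    simpa [add_assoc] using this
  rcases Nat.lt_or_ge (p + 1) (A.card + B.card) with hAB | hAB
  · have hA := hle A
    have hB := hle B
    have cA : Aᶜ.card = p - A.card := by rw [Finset.card_compl, ZMod.card]
    have cB : Bᶜ.card = p - B.card := by rw [Finset.card_compl, ZMod.card]
    have key := small Bᶜ Aᶜ (t + B.card - p) (s + A.card) (by omega) (by omega) (by omega)
      (by omega)
    rw [zeroSumCount_comm, zeroSumCount_comm (arc p _ _), cA, cB, ← compl_arc s hA,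
      ← compl_arc' t hB] at key
    have e1 := zeroSumCount_add_compl A B C
    have e2 := zeroSumCount_add_compl B Aᶜ C
    rw [zeroSumCount_comm B, zeroSumCount_comm Bᶜ] at e2
    have e3 := zeroSumCount_add_compl (arc p s A.card) (arc p t B.card) (arc p d C.card)
    have e4 := zeroSumCount_add_compl (arc p t B.card) (arc p s A.card)ᶜ (arc p d C.card)
    rw [zeroSumCount_comm (arc p t _), zeroSumCount_comm (arc p t _)ᶜ] at e4
    rw [Finset.card_compl, card_arc _ hA, card_arc _ (hle C), ZMod.card] at e4
    rw [card_arc _ hB, card_arc _ (hle C)] at e3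
    rw [cA] at e2
    omega
  · exact small A B s t h1 h2 hBA hAB

end Sets

section Order

lemma ordSeq_true_even (n : ℕ) : ordSeq p true (2 * n) = ((-n : ℤ) : ZMod p) := by
  simp [ordSeq, plusSeq]

lemma ordSeq_true_odd (n : ℕ) : ordSeq p true (2 * n + 1) = ((n + 1 : ℤ) : ZMod p) := by
  have h : (2 * n + 1 + 1) / 2 = n + 1 := by omega
  simp [ordSeq, plusSeq, Nat.add_mod, h]

lemma ordSeq_false (n : ℕ) : ordSeq p false n = -ordSeq p true n := rfl

lemma ordSeq_not (e : Bool) (n : ℕ) : ordSeq p (!e) n = -ordSeq p e n := by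
  cases e <;> simp [ordSeq_false]

lemma image_ordSeq (e : Bool) (L : ℕ) :
    (Finset.range L).image (ordSeq p e) = arc p (ordStart e L) L := by
  ext x
  constructor
  · intro hx
    obtain ⟨n, hn, rfl⟩ := Finset.mem_image.1 hx
    rw [Finset.mem_range] at hn
    obtain ⟨m, rfl | rfl⟩ := Nat.even_or_odd' n <;> cases e
    · exact mem_arc_of m (by rw [ordSeq_false, ordSeq_true_even]; simp)
        (by simp only [ordStart]; omega) (by simp only [ordStart]; omega)
    · exact mem_arc_of (-m) (ordSeq_true_even m)
        (by simp only [ordStart]; omega) (by simp only [ordStart]; omega)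
    · exact mem_arc_of (-(m + 1)) (by rw [ordSeq_false, ordSeq_true_odd]; simp)
        (by simp only [ordStart]; omega) (by simp only [ordStart]; omega)
    · exact mem_arc_of (m + 1) (ordSeq_true_odd m)
        (by simp only [ordStart]; omega) (by simp only [ordStart]; omega)
  · intro hx
    obtain ⟨k, hk, rfl⟩ := Finset.mem_image.1 hx
    rw [Finset.mem_range] at hk
    rw [Finset.mem_image]
    cases e
    · generalize ht : ordStart false L + (k : ℤ) = t
      simp only [ordStart] at ht
      rcases lt_or_ge t 0 with h0 | h0
      · refine ⟨2 * (-t - 1).toNat + 1, Finset.mem_range.2 (by omega), ?_⟩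
        rw [ordSeq_false, ordSeq_true_odd, ← Int.cast_neg]
        congr 1; omega
      · refine ⟨2 * t.toNat, Finset.mem_range.2 (by omega), ?_⟩
        rw [ordSeq_false, ordSeq_true_even, ← Int.cast_neg]
        congr 1; omega
    · generalize ht : ordStart true L + (k : ℤ) = t
      simp only [ordStart] at ht
      rcases lt_or_ge 0 t with h0 | h0
      · refine ⟨2 * (t - 1).toNat + 1, Finset.mem_range.2 (by omega), ?_⟩
        rw [ordSeq_true_odd]
        congr 1; omega
      · refine ⟨2 * (-t).toNat, Finset.mem_range.2 (by omega), ?_⟩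
        rw [ordSeq_true_even]
        congr 1; omega

lemma ordSeq_injOn (e : Bool) : Set.InjOn (ordSeq p e) (Finset.range p) := by
  rw [← Finset.card_image_iff, image_ordSeq, card_arc _ le_rfl, Finset.card_range]

lemma exists_ordSeq [NeZero p] (e : Bool) (x : ZMod p) : ∃ n < p, ordSeq p e n = x := by
  have huniv : (Finset.range p).image (ordSeq p e) = Finset.univ := by
    rw [← Finset.card_eq_iff_eq_univ, image_ordSeq, card_arc _ le_rfl, ZMod.card]
  have hx := huniv ▸ Finset.mem_univ x
  obtain ⟨n, hn, rfl⟩ := Finset.mem_image.1 hx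
  exact ⟨n, Finset.mem_range.1 hn, rfl⟩

/-- `u` is nonincreasing along `ordSeq p e`. -/
def IsOrdered (e : Bool) (u : ZMod p → ℝ) : Prop :=
  ∀ n : ℕ, n + 1 < p → u (ordSeq p e (n + 1)) ≤ u (ordSeq p e n)

/-- `f'` is a rearrangement of `f` that is nonincreasing along `ordSeq p e`. -/
def IsRearr (e : Bool) (f f' : ZMod p → ℝ) : Prop :=
  (∃ σ : Equiv.Perm (ZMod p), f' = f ∘ σ) ∧ IsOrdered e f'

lemma IsOrdered.isRearr {e : Bool} {u : ZMod p → ℝ} (hu : IsOrdered e u) : IsRearr e u u :=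
  ⟨⟨1, rfl⟩, hu⟩

lemma IsRearr.nonneg {e : Bool} {f f' : ZMod p → ℝ} (h : IsRearr e f f') (hf : ∀ x, 0 ≤ f x)
    (x : ZMod p) : 0 ≤ f' x := by
  obtain ⟨⟨σ, rfl⟩, -⟩ := h
  exact hf _

lemma exists_isRearr [NeZero p] (e : Bool) (f : ZMod p → ℝ) : ∃ f', IsRearr e f f' := by
  have hbij : Function.Bijective fun n : Fin p => ordSeq p e n := by
    rw [Fintype.bijective_iff_injective_and_card]
    refine ⟨fun m n h => Fin.ext ?_, by simp [ZMod.card]⟩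
    exact ordSeq_injOn e (by simp) (by simp) h
  let E : Fin p ≃ ZMod p := Equiv.ofBijective _ hbij
  let τ : Equiv.Perm (Fin p) := Tuple.sort fun n => -f (E n)
  have hτ : Monotone ((fun n => -f (E n)) ∘ τ) := Tuple.monotone_sort _
  refine ⟨f ∘ (E.symm.trans (τ.trans E)), ⟨_, rfl⟩, fun n hn => ?_⟩
  have hE : ∀ m (hm : m < p), E.symm (ordSeq p e m) = ⟨m, hm⟩ := fun m hm => by
    rw [Equiv.symm_apply_eq]; rfl
  have := hτ (a := ⟨n, by omega⟩) (b := ⟨n + 1, hn⟩) (Fin.mk_le_mk.2 (by omega))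
  simp only [Function.comp_apply, neg_le_neg_iff] at this
  simpa [hE n (by omega), hE (n + 1) hn] using this

/-- A layer-cake comparison: it suffices to compare the level sets of `f` and `f'`. -/
lemma IsRearr.sum_mul_le [NeZero p] {e : Bool} {f f' : ZMod p → ℝ} (h : IsRearr e f f')
    (hf : ∀ x, 0 ≤ f x) (w w' : ZMod p → ℝ)
    (hw : ∀ A : Finset (ZMod p),
      (∀ L, A.card = L + 1 → L + 1 < p → f' (ordSeq p e (L + 1)) ≠ f' (ordSeq p e L)) →
      ∑ x ∈ A, w x ≤ ∑ x ∈ arc p (ordStart e A.card) A.card, w' x) :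
    ∑ x, f x * w x ≤ ∑ x, f' x * w' x := by
  have hf' := h.nonneg hf
  obtain ⟨⟨σ, hσ⟩, hord⟩ := h
  set v : ℕ → ℝ := fun L => if L < p then f' (ordSeq p e L) else 0 with hv
  have hv0 : ∀ L, L < p → 0 ≤ v L - v (L + 1) := fun L hL => by
    by_cases hL' : L + 1 < p
    · simpa [hv, hL, hL'] using hord L hL'
    · simpa [hv, hL, hL'] using hf' _
  have tele : ∀ n N, n ≤ N →
      ∑ L ∈ Finset.range N, (if n ≤ L then v L - v (L + 1) else 0) = v n - v N := by
    intro n N hN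
    induction N, hN using Nat.le_induction with
    | base =>
      rw [sub_self]
      exact Finset.sum_eq_zero fun L hL => if_neg (by simpa using hL)
    | succ N hN ih => rw [Finset.sum_range_succ, ih, if_pos hN]; ring
  have hlayer : ∀ x, f' x = ∑ L ∈ Finset.range p,
      (v L - v (L + 1)) * if x ∈ arc p (ordStart e (L + 1)) (L + 1) then 1 else 0 := by
    intro x
    obtain ⟨n, hn, rfl⟩ := exists_ordSeq e x
    have := tele n p hn.le
    have h1 : v n = f' (ordSeq p e n) := if_pos hn
    have h2 : v p = 0 := if_neg (lt_irrefl _)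
    rw [h1, h2, sub_zero] at this
    rw [← this]
    refine Finset.sum_congr rfl fun L hL => ?_
    rw [Finset.mem_range] at hL
    rw [mul_ite, mul_one, mul_zero]
    refine if_congr ?_ rfl rfl
    rw [← image_ordSeq, Finset.mem_image]
    constructor
    · exact fun hnL => ⟨n, Finset.mem_range.2 (by omega), rfl⟩
    · rintro ⟨m, hm, hmn⟩
      rw [Finset.mem_range] at hm
      have := ordSeq_injOn e (by simp; omega) (by simpa using hn) hmn
      omega
  have hsum : ∀ W : ZMod p → ℝ, ∑ x, f' x * W x = ∑ L ∈ Finset.range p,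
      (v L - v (L + 1)) * ∑ x ∈ arc p (ordStart e (L + 1)) (L + 1), W x := by
    intro W
    simp_rw [hlayer, Finset.sum_mul]
    rw [Finset.sum_comm]
    refine Finset.sum_congr rfl fun L _ => ?_
    simp_rw [mul_assoc]
    rw [← Finset.mul_sum]
    simp
  have hfw : ∑ x, f x * w x = ∑ x, f' x * w (σ x) := by
    rw [hσ]
    exact (Equiv.sum_comp σ fun x => f x * w x).symm
  rw [hfw, hsum fun x => w (σ x), hsum w']
  refine Finset.sum_le_sum fun L hL => ?_
  rw [Finset.mem_range] at hL
  by_cases hc : v L - v (L + 1) = 0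
  · simp [hc]
  refine mul_le_mul_of_nonneg_left ?_ (hv0 L hL)
  have hcard := card_arc (p := p) (ordStart e (L + 1)) (L := L + 1) hL
  have := hw ((arc p (ordStart e (L + 1)) (L + 1)).map σ.toEmbedding) fun L' hL' hp' => by
    rw [Finset.card_map, hcard] at hL'
    obtain rfl : L = L' := by omega
    intro heq
    exact hc (by simp [hv, hL, hp', heq])
  rw [Finset.card_map, hcard, Finset.sum_map] at this
  exact this

end Order

section Kernels

/-- `k'` is a rearrangement of `k` all of whose proper level sets are intervals that balance an
interval in the `e₁`-order and one in the `e₂`-order. -/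
def IsKernel (e₁ e₂ : Bool) (k k' : ZMod p → ℝ) : Prop :=
  (∀ x, 0 ≤ k x) ∧ ∃ e, IsRearr e k k' ∧
    ∀ L, L + 1 < p → k' (ordSeq p e (L + 1)) ≠ k' (ordSeq p e L) → ∀ a b : ℕ,
      -1 ≤ 2 * ordStart e₁ a + a - 1 + (2 * ordStart e₂ b + b - 1) +
        (2 * ordStart e (L + 1) + (L + 1 : ℕ) - 1) ∧
      2 * ordStart e₁ a + a - 1 + (2 * ordStart e₂ b + b - 1) +
        (2 * ordStart e (L + 1) + (L + 1 : ℕ) - 1) ≤ 1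

lemma IsKernel.nonneg_right {e₁ e₂ : Bool} {k k' : ZMod p → ℝ} (h : IsKernel e₁ e₂ k k')
    (x : ZMod p) : 0 ≤ k' x := by
  obtain ⟨hk, e, hr, -⟩ := h
  exact hr.nonneg hk x

lemma IsKernel.self {e₁ e₂ : Bool} {k k' : ZMod p → ℝ} (h : IsKernel e₁ e₂ k k') :
    IsKernel e₁ e₂ k' k' := by
  refine ⟨h.nonneg_right, ?_⟩
  obtain ⟨hk, e, hr, hL⟩ := h
  exact ⟨e, hr.2.isRearr, hL⟩

lemma conv_comm [NeZero p] (f g : ZMod p → ℝ) : conv f g = conv g f := by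
  ext k
  unfold conv
  rw [← Equiv.sum_comp (Equiv.subLeft k)]
  refine Finset.sum_congr rfl fun i _ => ?_
  simp [mul_comm]

lemma conv_assoc [NeZero p] (f g h : ZMod p → ℝ) :
    conv (conv f g) h = conv f (conv g h) := by
  ext k
  unfold conv
  simp_rw [Finset.sum_mul, Finset.mul_sum]
  rw [Finset.sum_comm]
  refine Finset.sum_congr rfl fun i _ => ?_
  rw [← Equiv.sum_comp (Equiv.addLeft i)]
  refine Finset.sum_congr rfl fun j _ => ?_
  simp only [Equiv.coe_addLeft, add_sub_cancel_left]
  rw [mul_assoc, sub_sub]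

lemma conv_nonneg [NeZero p] {f g : ZMod p → ℝ} (hf : ∀ x, 0 ≤ f x) (hg : ∀ x, 0 ≤ g x)
    (k : ZMod p) : 0 ≤ conv f g k :=
  Finset.sum_nonneg fun _ _ => mul_nonneg (hf _) (hg _)

lemma conv_conv_zero [NeZero p] (f g h : ZMod p → ℝ) :
    conv f (conv g h) 0 = ∑ x, f x * ∑ y, g y * h (-(x + y)) := by
  unfold conv
  refine Finset.sum_congr rfl fun x _ => ?_
  congr 1
  refine Finset.sum_congr rfl fun y _ => ?_
  congr 2; ring

/-- The rearrangement inequality for three functions. -/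
lemma IsKernel.conv_le (hp : p.Prime) [NeZero p] {e₁ e₂ : Bool} {f f' g g' k k' : ZMod p → ℝ}
    (hf : ∀ x, 0 ≤ f x) (hg : ∀ x, 0 ≤ g x) (hff : IsRearr e₁ f f') (hgg : IsRearr e₂ g g')
    (hk : IsKernel e₁ e₂ k k') :
    conv f (conv g k) 0 ≤ conv f' (conv g' k') 0 := by
  obtain ⟨hk0, e, hkk, hL⟩ := hk
  rw [conv_conv_zero, conv_conv_zero]
  refine hff.sum_mul_le hf _ _ fun A _ => ?_
  rw [Finset.sum_comm, Finset.sum_comm (s := arc p _ _)]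
  simp_rw [← Finset.mul_sum]
  refine hgg.sum_mul_le hg _ _ fun B _ => ?_
  have hrep : ∀ (u : ZMod p → ℝ) (A B : Finset (ZMod p)), ∑ y ∈ B, ∑ x ∈ A, u (-(x + y)) =
      ∑ z, u z * ∑ y ∈ B, ∑ x ∈ A, if -(x + y) = z then 1 else 0 := by
    intro u A B
    simp_rw [Finset.mul_sum]
    rw [Finset.sum_comm (s := Finset.univ)]
    refine Finset.sum_congr rfl fun y _ => ?_
    rw [Finset.sum_comm (s := Finset.univ)]
    refine Finset.sum_congr rfl fun x _ => ?_
    simp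
  rw [hrep k, hrep k']
  refine hkk.sum_mul_le hk0 _ _ fun C hC => ?_
  have hcount : ∀ A B C : Finset (ZMod p), ∑ z ∈ C, ∑ y ∈ B, ∑ x ∈ A,
      (if -(x + y) = z then 1 else 0 : ℝ) = zeroSumCount A B C := by
    intro A B C
    rw [zeroSumCount_comm, zeroSumCount, Finset.sum_comm]
    push_cast
    refine Finset.sum_congr rfl fun y _ => ?_
    rw [Finset.sum_comm]
    refine Finset.sum_congr rfl fun x _ => ?_
    rw [Finset.sum_ite_eq, add_comm]
  rw [hcount, hcount, Nat.cast_le]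
  have hle : ∀ S : Finset (ZMod p), S.card ≤ p := fun S => by
    simpa [ZMod.card] using Finset.card_le_univ S
  rcases Nat.lt_or_ge C.card p with hCp | hCp
  · rcases Nat.eq_zero_or_pos C.card with h0 | h0
    · simp [zeroSumCount, Finset.card_eq_zero.1 h0]
    · obtain ⟨L, hCL⟩ : ∃ L, C.card = L + 1 := ⟨C.card - 1, by omega⟩
      obtain ⟨h1, h2⟩ := hL L (by omega) (hC L hCL (by omega)) A.card B.card
      rw [← hCL] at h1 h2
      exact zeroSumCount_le_arc hp A B C _ _ _ h1 h2
  · have huniv : ∀ C : Finset (ZMod p), C.card = p → C = Finset.univ := fun C hC => by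
      rwa [← Finset.card_eq_iff_eq_univ, ZMod.card]
    have hCp' := le_antisymm (hle C) hCp
    have hCp'' : (arc p (ordStart e C.card) C.card).card = p := by rw [card_arc _ (hle C), hCp']
    rw [huniv _ hCp'', huniv C hCp']
    simp [zeroSumCount, card_arc _ (hle A), card_arc _ (hle B)]

/-- Convolving an ordered function with a rearranged kernel gives an ordered function. -/
lemma IsKernel.isOrdered_conv (hp : p.Prime) [NeZero p] {e₁ e₂ : Bool} {u k k' : ZMod p → ℝ}
    (hu : ∀ x, 0 ≤ u x) (huo : IsOrdered e₁ u) (hk : IsKernel e₁ e₂ k k') :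
    IsOrdered (!e₂) (conv u k') := by
  intro n hn
  set q := ordSeq p e₂
  have hinj : ∀ i j, i < p → j < p → (q i = q j ↔ i = j) := fun i j hi hj =>
    ⟨fun h => ordSeq_injOn e₂ (by simpa using hi) (by simpa using hj) h, fun h => by rw [h]⟩
  let S : ℕ → Finset (ZMod p) := fun L => (Finset.range L).image q
  have hS : ∀ L ≤ p, ∀ m < p, (q m ∈ S L ↔ m < L) := by
    intro L hL m hm
    simp only [S, Finset.mem_image, Finset.mem_range]
    constructor
    · rintro ⟨i, hi, h⟩
      rw [hinj i m (by omega) hm] at h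
      omega
    · exact fun h => ⟨m, h, rfl⟩
  let w' : ZMod p → ℝ := fun x => if x ∈ S (n + 1) then 1 else 0
  let σ : Equiv.Perm (ZMod p) := Equiv.swap (q n) (q (n + 1))
  have hw'o : IsOrdered e₂ w' := by
    intro m hm
    change (if q (m + 1) ∈ S (n + 1) then (1 : ℝ) else 0) ≤ if q m ∈ S (n + 1) then 1 else 0
    have h1 := hS (n + 1) (by omega) (m + 1) hm
    have h2 := hS (n + 1) (by omega) m (by omega)
    split_ifs with h3 h4
    · exact le_rfl
    · exact absurd (h2.2 (by have := h1.1 h3; omega)) h4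
    · exact zero_le_one
    · exact le_rfl
  have hww : IsRearr e₂ (w' ∘ σ) w' := ⟨⟨σ, by ext x; simp [σ]⟩, hw'o⟩
  have key := hk.self.conv_le hp hu (g := w' ∘ σ) (fun x => by
    simp only [Function.comp_apply, w']; split_ifs <;> norm_num) huo.isRearr hww
  have hexp : ∀ w : ZMod p → ℝ, conv u (conv w k') 0 =
      ∑ x, w x * conv u k' (-x) := by
    intro w
    rw [conv_comm w, ← conv_assoc, conv_comm]
    simp [conv]
  rw [hexp, hexp, ← Equiv.sum_comp σ] at key
  have hind : ∀ v : ZMod p → ℝ, ∑ x, w' x * v x = ∑ m ∈ Finset.range n, v (q m) + v (q n) := by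
    intro v
    rw [← Finset.sum_range_succ, ← Finset.sum_image (f := v) (g := q)
      ((ordSeq_injOn e₂).mono (by simpa using Nat.le_of_lt hn))]
    simp only [w', ite_mul, one_mul, zero_mul, Finset.sum_ite_mem, Finset.univ_inter, S]
  have hσσ : ∀ x, (w' ∘ σ) (σ x) = w' x := fun x => by simp [σ]
  simp_rw [hσσ] at key
  rw [hind, hind fun x => conv u k' (-x)] at key
  have hσn : σ (q n) = q (n + 1) := Equiv.swap_apply_left _ _
  have hfix : ∀ m ∈ Finset.range n, σ (q m) = q m := fun m hm => by
    rw [Finset.mem_range] at hm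
    refine Equiv.swap_apply_of_ne_of_ne ?_ ?_ <;> rw [Ne, hinj _ _ (by omega) (by omega)] <;> omega
  rw [Finset.sum_congr rfl fun m hm => by rw [hfix m hm], hσn] at key
  rw [ordSeq_not, ordSeq_not]
  exact le_of_add_le_add_left key

/-- Pairs of lists of kernels, each compatible with the order produced by the ones after it. -/
inductive KernelChain (e₁ : Bool) : Bool → List (ZMod p → ℝ) → List (ZMod p → ℝ) → Prop
  | nil : KernelChain e₁ (!e₁) [] []
  | cons {e₂ d : Bool} {k k' : ZMod p → ℝ} {l l' : List (ZMod p → ℝ)} (hk : IsKernel d e₂ k k')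
      (hl : KernelChain e₁ (!d) l l') : KernelChain e₁ e₂ (k :: l) (k' :: l')

lemma KernelChain.nonneg {e₁ e₂ : Bool} {l l' : List (ZMod p → ℝ)} (h : KernelChain e₁ e₂ l l')
    [NeZero p] : (∀ x, 0 ≤ convList l x) ∧ ∀ x, 0 ≤ convList l' x := by
  induction h with
  | nil =>
    have : ∀ x : ZMod p, 0 ≤ convList [] x := fun x => by
      simp only [convList, List.foldr_nil]; split_ifs <;> norm_num
    exact ⟨this, this⟩
  | cons hk _ ih => exact ⟨conv_nonneg hk.1 ih.1, conv_nonneg hk.nonneg_right ih.2⟩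

lemma ordSeq_zero (e : Bool) : ordSeq p e 0 = 0 := by
  cases e <;> simp [ordSeq, plusSeq, minusSeq]

lemma isKernel_convList_nil (e : Bool) [NeZero p] :
    IsKernel e (!e) (convList [] : ZMod p → ℝ) (convList []) := by
  have hval : ∀ n < p, convList [] (ordSeq p true n) = if n = 0 then (1 : ℝ) else 0 := by
    intro n hn
    have hz := ordSeq_injOn (p := p) true (x₁ := n) (x₂ := 0) (by simpa using hn)
      (by simpa using NeZero.pos p)
    rw [ordSeq_zero] at hz
    simp only [convList, List.foldr_nil]
    refine if_congr ⟨hz, ?_⟩ rfl rfl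
    rintro rfl
    exact ordSeq_zero true
  refine ⟨fun x => ?_, true, IsOrdered.isRearr fun n hn => ?_, fun L hL hne a b => ?_⟩
  · simp only [convList, List.foldr_nil]; split_ifs <;> norm_num
  · rw [hval _ hn, hval _ (by omega), if_neg (by omega)]
    split_ifs <;> norm_num
  · rw [hval _ hL, hval _ (by omega)] at hne
    have : L = 0 := by
      by_contra h
      simp [h] at hne
    subst this
    cases e <;> simp only [ordStart, Bool.not_true, Bool.not_false] <;> omega

lemma conv_convList_nil [NeZero p] (f : ZMod p → ℝ) : conv f (convList []) = f := by
  ext k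
  simp [conv, convList, sub_eq_zero]

lemma KernelChain.isOrdered_conv (hp : p.Prime) [NeZero p] {e₁ e₂ : Bool}
    {l l' : List (ZMod p → ℝ)} (h : KernelChain e₁ e₂ l l') {u : ZMod p → ℝ} (hu : ∀ x, 0 ≤ u x)
    (huo : IsOrdered e₁ u) : IsOrdered (!e₂) (conv u (convList l')) := by
  induction h with
  | nil => rwa [conv_convList_nil, Bool.not_not]
  | @cons e₂ d k k' l l' hk hl ih =>
    rw [Bool.not_not] at ih
    have := hk.isOrdered_conv hp (conv_nonneg hu hl.nonneg.2) ih
    rwa [conv_assoc, conv_comm _ k'] at this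

/-- The rearrangement inequality for two functions and a chain of kernels. -/
lemma KernelChain.conv_le (hp : p.Prime) [NeZero p] {e₁ e₂ : Bool} {l l' : List (ZMod p → ℝ)}
    (h : KernelChain e₁ e₂ l l') {f f' g g' : ZMod p → ℝ} (hf : ∀ x, 0 ≤ f x)
    (hg : ∀ x, 0 ≤ g x) (hff : IsRearr e₁ f f') (hgg : IsRearr e₂ g g') :
    conv f (conv g (convList l)) 0 ≤ conv f' (conv g' (convList l')) 0 := by
  induction h generalizing g g' with
  | nil => exact (isKernel_convList_nil e₁).conv_le hp hf hg hff hgg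
  | @cons e₂ d k k' l l' hk hl ih =>
    obtain ⟨w, hw⟩ := exists_isRearr (!d) (conv g k)
    set u := conv f' (convList l') with hu
    have hu0 : ∀ x, 0 ≤ u x := conv_nonneg (hff.nonneg hf) hl.nonneg.2
    have huo : IsOrdered d u := by
      have := hl.isOrdered_conv hp (hff.nonneg hf) hff.2
      rwa [Bool.not_not] at this
    obtain ⟨⟨σ, rfl⟩, -⟩ := id hw
    let τ : Equiv.Perm (ZMod p) := (Equiv.neg _).trans (σ.trans (Equiv.neg _))
    have huu : IsRearr d (u ∘ τ.symm) u := ⟨⟨τ, by ext x; simp⟩, huo⟩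
    calc conv f (conv g (convList (k :: l))) 0
        = conv f (conv (conv g k) (convList l)) 0 := by
          rw [conv_assoc]; rfl
      _ ≤ conv f' (conv (conv g k ∘ σ) (convList l')) 0 :=
          ih (conv_nonneg hg hk.1) hw
      _ = conv (u ∘ τ.symm) (conv g k) 0 := by
          rw [conv_comm (_ ∘ σ), ← conv_assoc]
          change ∑ x, u x * conv g k (σ (0 - x)) = ∑ x, (u ∘ τ.symm) x * conv g k (0 - x)
          rw [← Equiv.sum_comp τ fun x => (u ∘ τ.symm) x * conv g k (0 - x)]
          simp [τ]
      _ ≤ conv u (conv g' k') 0 :=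
          hk.conv_le hp (fun _ => hu0 _) hg huu hgg
      _ = conv f' (conv g' (convList (k' :: l'))) 0 := by
          rw [hu, conv_assoc, conv_comm (convList l'), conv_assoc]; rfl

end Kernels

section Regular

lemma isKernel_of_symmetric {e : Bool} {h h' : ZMod p → ℝ} (hh : ∀ x, 0 ≤ h x)
    (hr : IsPlusRearr h h') (hsymm : ∀ z, h' (-z) = h' z) : IsKernel (!e) e h h' := by
  refine ⟨hh, true, hr, fun L hL hne a b => ?_⟩
  obtain ⟨m, rfl | rfl⟩ := Nat.even_or_odd' L
  · cases e <;> simp only [ordStart, Bool.not_true, Bool.not_false] <;> omega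
  · refine absurd ?_ hne
    rw [show 2 * m + 1 + 1 = 2 * (m + 1) by ring, ordSeq_true_even, ordSeq_true_odd, Int.cast_neg,
      hsymm]
    norm_cast

lemma apply_add_one_eq_apply_neg {s' s'' : ZMod p → ℝ} (hp' : IsOrdered true s')
    (hm' : IsOrdered false s'') (hsq : ∀ z, s' (z + 1) = s'' z) {m : ℕ} (hm : 2 * m + 1 < p) :
    s' ((m + 1 : ℤ) : ZMod p) = s' ((-m : ℤ) : ZMod p) := by
  have h1 := hp' (2 * m) hm
  have h2 := hm' (2 * m) hm
  rw [ordSeq_true_even, ordSeq_true_odd] at h1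
  rw [ordSeq_false, ordSeq_false, ordSeq_true_even, ordSeq_true_odd, ← hsq, ← hsq] at h2
  refine le_antisymm h1 ?_
  have e1 : ((-m : ℤ) : ZMod p) = -((m + 1 : ℤ) : ZMod p) + 1 := by push_cast; ring
  have e2 : ((m + 1 : ℤ) : ZMod p) = -((-m : ℤ) : ZMod p) + 1 := by push_cast; ring
  rwa [← e1, ← e2] at h2

lemma isKernel_plus_of_square {s s' s'' : ZMod p → ℝ} (hs : ∀ x, 0 ≤ s x)
    (hp' : IsPlusRearr s s') (hm' : IsMinusRearr s s'') (hsq : ∀ z, s' (z + 1) = s'' z) :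
    IsKernel false false s s' := by
  refine ⟨hs, true, hp', fun L hL hne a b => ?_⟩
  obtain ⟨m, rfl | rfl⟩ := Nat.even_or_odd' L
  · rw [ordSeq_true_even, ordSeq_true_odd] at hne
    exact absurd (apply_add_one_eq_apply_neg hp'.2 hm'.2 hsq hL) hne
  · simp only [ordStart]; omega

lemma isKernel_minus_of_square {s s' s'' : ZMod p → ℝ} (hs : ∀ x, 0 ≤ s x)
    (hp' : IsPlusRearr s s') (hm' : IsMinusRearr s s'') (hsq : ∀ z, s' (z + 1) = s'' z) :
    IsKernel true true s s'' := by
  refine ⟨hs, false, hm', fun L hL hne a b => ?_⟩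
  obtain ⟨m, rfl | rfl⟩ := Nat.even_or_odd' L
  · rw [ordSeq_false, ordSeq_false, ordSeq_true_even, ordSeq_true_odd, ← hsq, ← hsq] at hne
    refine absurd ?_ hne
    convert (apply_add_one_eq_apply_neg hp'.2 hm'.2 hsq hL).symm using 2 <;> push_cast <;> ring
  · simp only [ordStart]; omega

lemma kernelChain_square {m : ℕ} (s sp sm : Fin (2 * m) → ZMod p → ℝ)
    (hs : ∀ j i, 0 ≤ s j i)
    (hsreg : ∀ j, IsPlusRearr (s j) (sp j) ∧ IsMinusRearr (s j) (sm j) ∧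
      ∀ z, sp j (z + 1) = sm j z) :
    KernelChain true false (List.ofFn s)
      (List.ofFn fun j : Fin (2 * m) => if (j : ℕ) % 2 = 0 then sp j else sm j) := by
  induction m with
  | zero => simpa using KernelChain.nil (p := p) (e₁ := true)
  | succ m ih =>
    have hplus := fun j => isKernel_plus_of_square (hs j) (hsreg j).1 (hsreg j).2.1 (hsreg j).2.2
    have hminus := fun j => isKernel_minus_of_square (hs j) (hsreg j).1 (hsreg j).2.1 (hsreg j).2.2
    have tail := ih (fun j => s j.succ.succ) (fun j => sp j.succ.succ) (fun j => sm j.succ.succ)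
      (fun j => hs _) (fun j => hsreg _)
    change KernelChain true false (List.ofFn (n := 2 * m + 1 + 1) s)
      (List.ofFn (n := 2 * m + 1 + 1) fun j => if (j : ℕ) % 2 = 0 then sp j else sm j)
    rw [List.ofFn_succ, List.ofFn_succ, List.ofFn_succ, List.ofFn_succ]
    refine .cons (d := false) (by simpa using hplus 0) (.cons (d := true) ?_ ?_)
    · simpa using hminus 1
    · simpa [Nat.add_mod, add_assoc] using tail

lemma kernelChain_append_symmetric {n : ℕ} (h hstar : Fin n → ZMod p → ℝ)
    (hh : ∀ j i, 0 ≤ h j i)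
    (hreg : ∀ j, IsPlusRearr (h j) (hstar j) ∧ ∀ z, hstar j (-z) = hstar j z) {e₁ e₂ : Bool}
    {l l' : List (ZMod p → ℝ)} (hl : KernelChain e₁ e₂ l l') :
    KernelChain e₁ e₂ (List.ofFn h ++ l) (List.ofFn hstar ++ l') := by
  induction n with
  | zero => simpa using hl
  | succ n ih =>
    rw [List.ofFn_succ, List.ofFn_succ]
    refine .cons (isKernel_of_symmetric (hh 0) (hreg 0).1 (hreg 0).2) ?_
    rw [Bool.not_not]
    exact ih _ _ (fun j => hh _) fun j => hreg _

end Regular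

/-- Generalized rearrangement inequality: for nonnegative `f, g`, `△`-regular
`h₁, ..., hₙ` and `□`-regular `s₁, ..., s_{2m}` on `ZMod p`,
`(f ⋆ g ⋆ h₁ ⋆ ⋯ ⋆ hₙ ⋆ s₁ ⋆ ⋯ ⋆ s_{2m})(0)
  ≤ (f⁺ ⋆ g⁻ ⋆ h₁* ⋆ ⋯ ⋆ hₙ* ⋆ s₁⁺ ⋆ s₂⁻ ⋆ ⋯ ⋆ s_{2m-1}⁺ ⋆ s_{2m}⁻)(0)`. -/
theorem generalized_rearrangement (hp : p.Prime) (hodd : p ≠ 2) [NeZero p] {n m : ℕ}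
    (f g : ZMod p → ℝ) (hf : ∀ i, 0 ≤ f i) (hg : ∀ i, 0 ≤ g i)
    (fp fm : ZMod p → ℝ) (hfp : IsPlusRearr f fp) (hgm : IsMinusRearr g fm)
    (h hstar : Fin n → ZMod p → ℝ) (hh : ∀ j i, 0 ≤ h j i)
    (hreg : ∀ j, IsPlusRearr (h j) (hstar j) ∧ ∀ z, hstar j (-z) = hstar j z)
    (s sp sm : Fin (2 * m) → ZMod p → ℝ) (hs : ∀ j i, 0 ≤ s j i)
    (hsreg : ∀ j, IsPlusRearr (s j) (sp j) ∧ IsMinusRearr (s j) (sm j) ∧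
      ∀ z, sp j (z + 1) = sm j z) :
    convList (f :: g :: (List.ofFn h ++ List.ofFn s)) 0 ≤
      convList (fp :: fm :: (List.ofFn hstar ++
        List.ofFn (fun j : Fin (2 * m) => if (j : ℕ) % 2 = 0 then sp j else sm j))) 0 := by
  have hchain := kernelChain_append_symmetric h hstar hh hreg (kernelChain_square s sp sm hs hsreg)
  exact hchain.conv_le hp hf hg hfp hgm

end Paper
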